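/- (Correctness of the centralized three-erasure repair scheme.) Assume the extension degree t is divisible by the characteristic p of F. Let k = |B|^t − |B|^{t−1} and let α*, ᾱ, α' ∈ F be three distinct elements such that at least one of the three elements (ᾱ − α*)/(ᾱ − α'), (α' − ᾱ)/(α' − α*), (α* − α')/(α* − ᾱ) lies in K = ker(Tr_{F/B}). If f ∈ F[x] is a polynomial with deg f ≤ k − 1 such that Tr_{F/B}(f(α)/(α − α*)) = 0, Tr_{F/B}(f(α)/(α − ᾱ)) = 0, and Tr_{F/B}(f(α)/(α − α')) = 0 for every α ∈ F \ {α*, ᾱ, α'}, then f(α*) = f(ᾱ) = f(α') = 0. In particular, the triple (f(α*), f(ᾱ), f(α')) is determined by the 3(|F| − 3) sub-symbols Tr_{F/B}(f(α)/(α − α*)), Tr_{F/B}(f(α)/(α − ᾱ)), Tr_{F/B}(f(α)/(α − α')) ∈ B, α ∈ F \ {α*, ᾱ, α'}. -/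

import Mathlib

open Polynomial

/-- The field trace `Tr_{F/B}(x) = ∑_{i=0}^{t-1} x^{q^i}` (with `q = |B|`). -/
noncomputable def fTr (q t : ℕ) {F : Type*} [Field F] (x : F) : F :=
  ∑ i ∈ Finset.range t, x ^ q ^ i

section RepairScheme

variable {B F : Type*} [Field B] [Field F] [Algebra B F]

/-- The formula `fTr` agrees with Mathlib's trace of an extension of finite fields. -/
lemma fTr_eq_algebraMap_trace [Fintype B] [Fintype F] {t : ℕ}
    (hF : Fintype.card F = Fintype.card B ^ t) (x : F) :
    fTr (Fintype.card B) t x = algebraMap B F (Algebra.trace B F x) := by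
  have hfin : Module.finrank B F = t := by
    have h := Module.card_eq_pow_finrank (K := B) (V := F)
    rw [hF] at h
    exact (Nat.pow_right_injective Fintype.one_lt_card h).symm
  rw [FiniteField.algebraMap_trace_eq_sum_pow, hfin, Nat.card_eq_fintype_card, fTr]

/-- The values of a low degree polynomial over a finite field sum to zero. -/
lemma sum_eval_eq_zero_of_natDegree_lt [Fintype F] (f : F[X])
    (hf : f.natDegree < Fintype.card F - 1) : ∑ x : F, f.eval x = 0 := by
  simp_rw [eval_eq_sum_range' hf]
  rw [Finset.sum_comm]
  refine Finset.sum_eq_zero fun i hi => ?_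
  rw [← Finset.mul_sum, FiniteField.sum_pow_lt_card_sub_one F i (Finset.mem_range.mp hi), mul_zero]

/-- The polynomial `Tr(u (x - a)) / (x - a)`, where `Tr(x) = ∑_{i < t} x ^ q ^ i`. -/
noncomputable def checkPoly (q t : ℕ) (u a : F) : F[X] :=
  ∑ i ∈ Finset.range t, C (u ^ q ^ i) * (X - C a) ^ (q ^ i - 1)

lemma natDegree_checkPoly_le {q : ℕ} (hq : 1 < q) (t : ℕ) (u a : F) :
    (checkPoly q t u a).natDegree ≤ q ^ (t - 1) - 1 := by
  refine natDegree_sum_le_of_forall_le _ _ fun i hi => ?_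
  refine (natDegree_C_mul_le _ _).trans (natDegree_pow_le.trans ?_)
  rw [natDegree_X_sub_C, mul_one]
  exact Nat.sub_le_sub_right
    (Nat.pow_le_pow_right hq.le (Nat.le_sub_one_of_lt (Finset.mem_range.mp hi))) 1

lemma eval_checkPoly_self {q t : ℕ} (hq : 1 < q) (ht : 0 < t) (u a : F) :
    (checkPoly q t u a).eval a = u := by
  rw [checkPoly, eval_finsetSum, Finset.sum_eq_single 0]
  · simp
  · intro i _ hi
    have : q ^ i - 1 ≠ 0 := Nat.sub_ne_zero_of_lt (Nat.one_lt_pow hi hq)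
    simp [this]
  · intro h
    exact absurd (Finset.mem_range.mpr ht) h

lemma eval_checkPoly_of_ne {q t : ℕ} (hq : 1 < q) (u : F) {a x : F} (hx : x ≠ a) :
    (checkPoly q t u a).eval x = fTr q t (u * (x - a)) / (x - a) := by
  have hxa : x - a ≠ 0 := sub_ne_zero.mpr hx
  rw [eq_div_iff hxa, checkPoly, eval_finsetSum, Finset.sum_mul, fTr]
  refine Finset.sum_congr rfl fun i _ => ?_
  have h : q ^ i - 1 + 1 = q ^ i := Nat.sub_add_cancel (Nat.pow_pos (by omega))
  simp only [eval_mul, eval_C, eval_pow, eval_sub, eval_X]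
  rw [mul_assoc, ← pow_succ, h, mul_pow]

/-- Interpolation of `f a` from the traces of `f x / (x - a)` for low degree `f`. -/
lemma eval_add_sum_trace_smul_eq_zero [Fintype B] [Fintype F] {t : ℕ} (ht : 0 < t)
    (hF : Fintype.card F = Fintype.card B ^ t) (f : F[X])
    (hf : f.natDegree ≤ Fintype.card B ^ t - Fintype.card B ^ (t - 1) - 1) (a : F) :
    f.eval a + ∑ x : F, Algebra.trace B F (f.eval x / (x - a)) • (x - a) = 0 := by
  classical
  have hq : 1 < Fintype.card B := Fintype.one_lt_card
  refine (traceForm_nondegenerate B F).1 _ fun u => ?_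
  have hlt : Fintype.card B ^ (t - 1) < Fintype.card B ^ t := Nat.pow_lt_pow_right hq (by omega)
  have hpos : 0 < Fintype.card B ^ (t - 1) := Nat.pow_pos (by omega)
  have hsum := sum_eval_eq_zero_of_natDegree_lt (f * checkPoly (Fintype.card B) t u a) (by
    have h1 := natDegree_mul_le (p := f) (q := checkPoly (Fintype.card B) t u a)
    have h2 := natDegree_checkPoly_le hq t u a
    omega)
  have hterm : ∀ x : F, (f * checkPoly (Fintype.card B) t u a).eval x =
      (if x = a then f.eval a * u else 0) +
        Algebra.trace B F (u * (x - a)) • (f.eval x / (x - a)) := by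
    intro x
    rw [eval_mul]
    by_cases hx : x = a
    · subst hx
      simp [eval_checkPoly_self hq ht]
    · rw [eval_checkPoly_of_ne hq u hx, if_neg hx, zero_add, fTr_eq_algebraMap_trace hF,
        Algebra.smul_def]
      ring
  simp_rw [hterm] at hsum
  rw [Finset.sum_add_distrib, Finset.sum_ite_eq' Finset.univ a, if_pos (Finset.mem_univ a)] at hsum
  have htr := congrArg (Algebra.trace B F) hsum
  rw [map_add, map_sum, map_zero] at htr
  rw [Algebra.traceForm_apply, add_mul, map_add, Finset.sum_mul, map_sum, ← htr]
  congr 1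
  refine Finset.sum_congr rfl fun x _ => ?_
  rw [smul_mul_assoc, map_smul, map_smul, smul_eq_mul, smul_eq_mul, mul_comm u, mul_comm]

lemma map_div_of_add_smul_eq_zero (L : F →ₗ[B] B) (hL : L 1 = 0) {a b c x : F} (hab : a ≠ b)
    {r s : B} (h : x + (r • (b - a) + s • (c - a)) = 0) :
    L (x / (a - b)) = s * L ((c - b) / (b - a)) := by
  have hab' : a - b ≠ 0 := sub_ne_zero.mpr hab
  have hba : b - a ≠ 0 := sub_ne_zero.mpr hab.symm
  have hx : x / (a - b) = (r + s) • (1 : F) + s • ((c - b) / (b - a)) := by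
    simp only [Algebra.smul_def, map_add] at h ⊢
    rw [eq_neg_of_add_eq_zero_left h]
    field_simp
    ring
  rw [hx, map_add, map_smul, map_smul, hL, smul_zero, zero_add, smul_eq_mul]

lemma map_sub_div_eq_zero (L : F →ₗ[B] B) (hL : L 1 = 0) {a b c : F} (hbc : b ≠ c)
    (h : L ((b - a) / (b - c)) = 0) : L ((c - a) / (c - b)) = 0 := by
  have hbc' : b - c ≠ 0 := sub_ne_zero.mpr hbc
  have hcb : c - b ≠ 0 := sub_ne_zero.mpr hbc.symm
  have e : (c - a) / (c - b) = 1 - (b - a) / (b - c) := by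
    field_simp
    ring
  rw [e, map_sub, hL, h, sub_zero]

/-- The linear system relating three erased values has only the trivial solution. -/
lemma eq_zero_of_three_erasures (L : F →ₗ[B] B) (hL : L 1 = 0) {a b c x y z : F}
    (hab : a ≠ b) (hbc : b ≠ c) (hac : a ≠ c) (h : L ((b - a) / (b - c)) = 0)
    (hx : x + (L (y / (b - a)) • (b - a) + L (z / (c - a)) • (c - a)) = 0)
    (hy : y + (L (z / (c - b)) • (c - b) + L (x / (a - b)) • (a - b)) = 0)
    (hz : z + (L (x / (a - c)) • (a - c) + L (y / (b - c)) • (b - c)) = 0) :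
    x = 0 ∧ y = 0 ∧ z = 0 := by
  have h' := map_sub_div_eq_zero L hL hbc h
  have hneg : L ((a - c) / (c - b)) = 0 := by
    rw [← neg_sub c a, neg_div, map_neg, h', neg_zero]
  have hneg' : L ((a - b) / (b - c)) = 0 := by
    rw [← neg_sub b a, neg_div, map_neg, h, neg_zero]
  have hyc : L (y / (b - c)) = 0 := by
    rw [map_div_of_add_smul_eq_zero L hL hbc hy, hneg, mul_zero]
  have hzb : L (z / (c - b)) = 0 := by
    rw [add_comm (_ • _)] at hz
    rw [map_div_of_add_smul_eq_zero L hL hbc.symm hz, hneg', mul_zero]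
  have hza : L (z / (c - a)) = 0 := by
    rw [map_div_of_add_smul_eq_zero L hL hac.symm hz, hyc, zero_mul]
  have hya : L (y / (b - a)) = 0 := by
    rw [add_comm (_ • _)] at hy
    rw [map_div_of_add_smul_eq_zero L hL hab.symm hy, hzb, zero_mul]
  have hx0 : x = 0 := by simpa [hya, hza] using hx
  subst hx0
  exact ⟨rfl, by simpa [hzb] using hy, by simpa [hyc] using hz⟩

/-- A sum over a type with at most two nonzero terms, at the points `b ≠ c`. -/
lemma sum_eq_add_of_support_pair [Fintype F] {b c : F} (hbc : b ≠ c) (g : F → F)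
    (hg : ∀ x, x ≠ b → x ≠ c → g x = 0) : ∑ x, g x = g b + g c := by
  classical
  rw [← Finset.sum_pair hbc]
  refine (Finset.sum_subset (Finset.subset_univ _) fun x _ hx => ?_).symm
  simp only [Finset.mem_insert, Finset.mem_singleton, not_or] at hx
  exact hg x hx.1 hx.2

/-- The values of `f` at three erased points vanish if all the downloaded traces do. -/
lemma eval_eq_zero_of_trace_eq_zero [Fintype B] [Fintype F] {t : ℕ} (ht : 0 < t)
    (hF : Fintype.card F = Fintype.card B ^ t) (h1 : Algebra.trace B F 1 = 0) {a b c : F}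
    (hab : a ≠ b) (hbc : b ≠ c) (hac : a ≠ c)
    (hact : Algebra.trace B F ((b - a) / (b - c)) = 0 ∨
      Algebra.trace B F ((c - b) / (c - a)) = 0 ∨ Algebra.trace B F ((a - c) / (a - b)) = 0)
    (f : F[X]) (hf : f.natDegree ≤ Fintype.card B ^ t - Fintype.card B ^ (t - 1) - 1)
    (hfx : ∀ x, x ≠ a → x ≠ b → x ≠ c → Algebra.trace B F (f.eval x / (x - a)) = 0 ∧
      Algebra.trace B F (f.eval x / (x - b)) = 0 ∧ Algebra.trace B F (f.eval x / (x - c)) = 0) :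
    f.eval a = 0 ∧ f.eval b = 0 ∧ f.eval c = 0 := by
  have ha := eval_add_sum_trace_smul_eq_zero ht hF f hf a
  have hb := eval_add_sum_trace_smul_eq_zero ht hF f hf b
  have hc := eval_add_sum_trace_smul_eq_zero ht hF f hf c
  rw [sum_eq_add_of_support_pair hbc _ fun x hxb hxc => by
    by_cases hxa : x = a
    · simp [hxa]
    · simp [(hfx x hxa hxb hxc).1]] at ha
  rw [sum_eq_add_of_support_pair hac.symm _ fun x hxc hxa => by
    by_cases hxb : x = b
    · simp [hxb]
    · simp [(hfx x hxa hxb hxc).2.1]] at hb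
  rw [sum_eq_add_of_support_pair hab _ fun x hxa hxb => by
    by_cases hxc : x = c
    · simp [hxc]
    · simp [(hfx x hxa hxb hxc).2.2]] at hc
  rcases hact with h | h | h
  · exact eq_zero_of_three_erasures _ h1 hab hbc hac h ha hb hc
  · obtain ⟨hb, hc, ha⟩ := eq_zero_of_three_erasures _ h1 hbc hac.symm hab.symm h hb hc ha
    exact ⟨ha, hb, hc⟩
  · obtain ⟨hc, ha, hb⟩ := eq_zero_of_three_erasures _ h1 hac.symm hab hbc.symm h hc ha hb
    exact ⟨ha, hb, hc⟩

end RepairScheme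

/-- Correctness of the centralized three-erasure repair scheme. Assume `p ∣ t`, let
`k = |B|^t - |B|^{t-1}`, and let `α*, ᾱ, α' ∈ F` be distinct with at least one of
`(ᾱ-α*)/(ᾱ-α')`, `(α'-ᾱ)/(α'-α*)`, `(α*-α')/(α*-ᾱ)` in `K = ker Tr`. If
`deg f ≤ k - 1` and `Tr(f(α)/(α-α*)) = Tr(f(α)/(α-ᾱ)) = Tr(f(α)/(α-α')) = 0` for every
`α ∈ F \ {α*, ᾱ, α'}`, then `f(α*) = f(ᾱ) = f(α') = 0`. In particular the triple
`(f(α*), f(ᾱ), f(α'))` is determined by the `3(|F|-3)` corresponding sub-symbols. -/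
theorem stmt17 (p m t : ℕ) (hp : p.Prime) (hm : 0 < m) (ht : 0 < t)
    (B F : Type*) [Field B] [Field F] [Algebra B F] [Fintype B] [Fintype F]
    (hB : Fintype.card B = p ^ m) (hF : Fintype.card F = Fintype.card B ^ t)
    [CharP F p] (hpt : p ∣ t)
    (k : ℕ) (hk : k = Fintype.card B ^ t - Fintype.card B ^ (t - 1))
    (αs αb αp : F) (h1 : αs ≠ αb) (h2 : αb ≠ αp) (h3 : αs ≠ αp)
    (hact : fTr (Fintype.card B) t ((αb - αs) / (αb - αp)) = 0 ∨
      fTr (Fintype.card B) t ((αp - αb) / (αp - αs)) = 0 ∨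
      fTr (Fintype.card B) t ((αs - αp) / (αs - αb)) = 0) :
    (∀ f : Polynomial F, f.degree ≤ ((k - 1 : ℕ) : WithBot ℕ) →
      (∀ α : F, α ≠ αs → α ≠ αb → α ≠ αp →
        fTr (Fintype.card B) t (f.eval α / (α - αs)) = 0 ∧
        fTr (Fintype.card B) t (f.eval α / (α - αb)) = 0 ∧
        fTr (Fintype.card B) t (f.eval α / (α - αp)) = 0) →
      f.eval αs = 0 ∧ f.eval αb = 0 ∧ f.eval αp = 0) ∧
    (∀ f g : Polynomial F, f.degree ≤ ((k - 1 : ℕ) : WithBot ℕ) →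
      g.degree ≤ ((k - 1 : ℕ) : WithBot ℕ) →
      (∀ α : F, α ≠ αs → α ≠ αb → α ≠ αp →
        fTr (Fintype.card B) t (f.eval α / (α - αs))
          = fTr (Fintype.card B) t (g.eval α / (α - αs)) ∧
        fTr (Fintype.card B) t (f.eval α / (α - αb))
          = fTr (Fintype.card B) t (g.eval α / (α - αb)) ∧
        fTr (Fintype.card B) t (f.eval α / (α - αp))
          = fTr (Fintype.card B) t (g.eval α / (α - αp))) →
      f.eval αs = g.eval αs ∧ f.eval αb = g.eval αb ∧ f.eval αp = g.eval αp) := by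
  have htr := fun x : F => fTr_eq_algebraMap_trace (B := B) hF x
  have hinj := FaithfulSMul.algebraMap_injective B F
  have hone : Algebra.trace B F 1 = 0 := by
    apply hinj
    rw [← htr, map_zero, fTr]
    simp [(CharP.cast_eq_zero_iff F p t).mpr hpt]
  simp only [htr, hinj.eq_iff, map_eq_zero_iff _ hinj] at hact ⊢
  subst hk
  have key : ∀ f : F[X], f.degree ≤ ((_ : ℕ) : WithBot ℕ) → _ := fun f hf =>
    eval_eq_zero_of_trace_eq_zero ht hF hone h1 h2 h3 hact f (natDegree_le_of_degree_le hf)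
  refine ⟨key, fun f g hf hg hfg => ?_⟩
  have h := key (f - g) ((degree_sub_le f g).trans (max_le hf hg)) fun x hxs hxb hxp => by
    simpa only [eval_sub, sub_div, map_sub, sub_eq_zero] using hfg x hxs hxb hxp
  simpa only [eval_sub, sub_eq_zero] using h
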